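/- In the mildly ill-posed case, the series Σ_{j≥1} (1 − τ² c_{0j}/c_j)² converges if and only if β < α + ℓ − 1/4. In particular, if β ≥ α + ℓ − 1/4 then this series diverges, so the operator T = I − τ² C^{-1/2} C₀ C^{-1/2} is not Hilbert–Schmidt and the posterior N(m,C) is not absolutely continuous with respect to the prior N(0, τ²C₀), independently of the data. [Proposition of Section 3.] -/

import Mathlib

/-- Prior covariance eigenvalues `c_{0j} = j^{-2α}`. -/
noncomputable def priorEig (α : ℝ) (j : ℕ) : ℝ := (j : ℝ) ^ (-(2 * α))

/-- Noise covariance eigenvalues `c_{1j} = j^{-2β}`. -/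
noncomputable def noiseEig (β : ℝ) (j : ℕ) : ℝ := (j : ℝ) ^ (-(2 * β))

/-- Posterior covariance eigenvalues
`c_j = τ² λ c_{0j} c_{1j} / (c_{0j} l_j² + λ c_{1j})`. -/
noncomputable def postEig (τ lam α β : ℝ) (l : ℕ → ℝ) (j : ℕ) : ℝ :=
  τ ^ 2 * lam * priorEig α j * noiseEig β j /
    (priorEig α j * (l j) ^ 2 + lam * noiseEig β j)

theorem priorEig_pos (α : ℝ) {j : ℕ} (hj : 1 ≤ j) : 0 < priorEig α j :=
  Real.rpow_pos_of_pos (by exact_mod_cast hj) _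

theorem noiseEig_pos (β : ℝ) {j : ℕ} (hj : 1 ≤ j) : 0 < noiseEig β j :=
  Real.rpow_pos_of_pos (by exact_mod_cast hj) _

/-- The deviation of the prior-to-posterior variance ratio from one. -/
theorem one_sub_priorEig_div_postEig {τ lam : ℝ} (α β : ℝ) (hτ : 0 < τ) (hlam : 0 < lam)
    (l : ℕ → ℝ) {j : ℕ} (hj : 1 ≤ j) :
    1 - τ ^ 2 * priorEig α j / postEig τ lam α β l j =
      -(priorEig α j * l j ^ 2 / (lam * noiseEig β j)) := by
  have h0 := priorEig_pos α hj
  have h1 := noiseEig_pos β hj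
  have hD : 0 < priorEig α j * l j ^ 2 + lam * noiseEig β j := by positivity
  unfold postEig
  field_simp
  ring

theorem sq_one_sub_priorEig_div_postEig {τ lam : ℝ} (α β : ℝ) (hτ : 0 < τ) (hlam : 0 < lam)
    (l : ℕ → ℝ) {j : ℕ} (hj : 1 ≤ j) :
    (1 - τ ^ 2 * priorEig α j / postEig τ lam α β l j) ^ 2 =
      l j ^ 4 * (j : ℝ) ^ (-(4 * (α - β))) / lam ^ 2 := by
  have hj0 : (0 : ℝ) < j := by exact_mod_cast hj
  have hratio : priorEig α j / noiseEig β j = (j : ℝ) ^ (-(2 * (α - β))) := by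
    rw [priorEig, noiseEig, ← Real.rpow_sub hj0]
    ring_nf
  have hsq : (j : ℝ) ^ (-(4 * (α - β))) = (priorEig α j / noiseEig β j) ^ 2 := by
    rw [hratio, ← Real.rpow_mul_natCast hj0.le]
    push_cast
    ring_nf
  have h1 := noiseEig_pos β hj
  rw [one_sub_priorEig_div_postEig α β hτ hlam l hj, hsq]
  field_simp

theorem pow_four_mul_rpow (a ℓ α β : ℝ) {x : ℝ} (hx : 0 < x) :
    (a * x ^ (-ℓ)) ^ 4 * x ^ (-(4 * (α - β))) = a ^ 4 * x ^ (-(4 * (α + ℓ - β))) := by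
  rw [mul_pow, mul_assoc, ← Real.rpow_mul_natCast hx.le, ← Real.rpow_add hx]
  push_cast
  ring_nf

/-- A nonnegative sequence squeezed between two positive multiples of a sequence is summable
exactly when that sequence is. -/
theorem summable_iff_of_le_of_le {f g : ℕ → ℝ} {a b : ℝ} (ha : 0 < a) (hg : ∀ j, 0 ≤ g j)
    (hlower : ∀ j, a * g j ≤ f j) (hupper : ∀ j, f j ≤ b * g j) :
    Summable f ↔ Summable g := by
  constructor
  · intro h
    exact (summable_mul_left_iff ha.ne').mp
      (h.of_nonneg_of_le (fun j => mul_nonneg ha.le (hg j)) hlower)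
  · intro h
    exact (h.mul_left b).of_nonneg_of_le
      (fun j => (mul_nonneg ha.le (hg j)).trans (hlower j)) hupper

/-- Proposition of Section 3 (mildly ill-posed case, `l_j ≍ j^{-ℓ}`): the series
`Σ_{j≥1} (1 − τ² c_{0j}/c_j)²` converges if and only if `β < α + ℓ − 1/4`. In
particular if `β ≥ α + ℓ − 1/4` then `T = I − τ² C^{-1/2} C₀ C^{-1/2}` is not
Hilbert–Schmidt and the posterior is not absolutely continuous with respect to
the prior. -/
theorem mildly_illposed_equivalence_iff
    (ℓ α β τ lam : ℝ) (hℓ : 0 < ℓ)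
    (hα : 1 / 2 < α) (hβ : 0 ≤ β) (hτ : 0 < τ) (hlam : 0 < lam)
    (l : ℕ → ℝ) (m M : ℝ) (hm : 0 < m) (hmM : m ≤ M)
    (hl : ∀ j : ℕ, 1 ≤ j →
      m * (j : ℝ) ^ (-ℓ) ≤ l j ∧ l j ≤ M * (j : ℝ) ^ (-ℓ)) :
    Summable (fun j : ℕ =>
      (1 - τ ^ 2 * priorEig α (j + 1) / postEig τ lam α β l (j + 1)) ^ 2) ↔
    β < α + ℓ - 1 / 4 := by
  have hrate : Summable (fun j : ℕ => ((j + 1 : ℕ) : ℝ) ^ (-(4 * (α + ℓ - β)))) ↔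
      β < α + ℓ - 1 / 4 := by
    rw [summable_nat_add_iff 1 (f := fun j : ℕ => (j : ℝ) ^ (-(4 * (α + ℓ - β)))),
      Real.summable_nat_rpow]
    constructor <;> intro h <;> linarith
  rw [← hrate]
  refine summable_iff_of_le_of_le (a := m ^ 4 / lam ^ 2) (b := M ^ 4 / lam ^ 2)
    (by positivity) (fun j => by positivity) (fun j => ?_) (fun j => ?_)
  all_goals
    have hj : 1 ≤ j + 1 := Nat.le_add_left 1 j
    have hj0 : (0 : ℝ) < ((j + 1 : ℕ) : ℝ) := by positivity
    obtain ⟨hlo, hhi⟩ := hl (j + 1) hj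
    have hlow : 0 ≤ m * ((j + 1 : ℕ) : ℝ) ^ (-ℓ) := by positivity
    have hl0 : 0 ≤ l (j + 1) := hlow.trans hlo
    rw [sq_one_sub_priorEig_div_postEig α β hτ hlam l hj, div_mul_eq_mul_div,
      ← pow_four_mul_rpow _ ℓ α β hj0]
    gcongr
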